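/- arXiv:1111.6502 — 8 statements merged into one kernel-verified Lean document; each statement's English description precedes it below -/
import Mathlib

section
/- Assume s₁ > s₂. For every fixed total power P > 0, the function r ↦ h₁(P, r) is strictly concave on the interval [0, (1/2)·log₂(1 + s₂·P/σ²)]. -/
open Real Set

/-- The stronger user's rate on the two-user AWGN BC, as a function of total power `P`
and the weaker user's rate `r`. -/
noncomputable def h1 (σ2 s1 s2 P r : ℝ) : ℝ :=
  (1/2) * Real.logb 2 (1 + (s1 / (s2 * σ2)) * ((P * s2 + σ2) * (2:ℝ) ^ (-(2*r)) - σ2))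

/-- The logarithm of a decaying exponential minus a positive constant is strictly concave
wherever its argument is positive. -/
theorem strictConcaveOn_log_mul_exp_neg_sub {A C k : ℝ} (hA : 0 < A) (hC : 0 < C) (hk : 0 < k)
    {D : Set ℝ} (hD : Convex ℝ D) (hpos : ∀ x ∈ D, 0 < A * exp (-(k * x)) - C) :
    StrictConcaveOn ℝ D (fun x => log (A * exp (-(k * x)) - C)) := by
  have hderiv : ∀ x ∈ D, HasDerivAt (fun x => log (A * exp (-(k * x)) - C))
      (A * (exp (-(k * x)) * -(k * 1)) / (A * exp (-(k * x)) - C)) x := fun x hx =>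
    (((((hasDerivAt_id x).const_mul k).neg.exp).const_mul A).sub_const C).log (hpos x hx).ne'
  refine StrictAntiOn.strictConcaveOn_of_deriv hD
    (fun x hx => (hderiv x hx).continuousAt.continuousWithinAt) ?_
  intro x hx y hy hxy
  have hx' := interior_subset hx
  have hy' := interior_subset hy
  have hexp : exp (-(k * y)) < exp (-(k * x)) :=
    exp_lt_exp.2 (neg_lt_neg (mul_lt_mul_of_pos_left hxy hk))
  rw [(hderiv x hx').deriv, (hderiv y hy').deriv, div_lt_div_iff₀ (hpos y hy') (hpos x hx')]
  have := mul_pos (mul_pos (mul_pos hA hk) hC) (sub_pos.2 hexp)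
  linarith

/-- For every fixed total power `P > 0`, the map `r ↦ h1 P r` is strictly concave
on `[0, (1/2)·log₂(1 + s₂·P/σ²)]` (strictness uses `s₁ > s₂`). -/
theorem h1_strictConcaveOn_rate (σ2 s1 s2 : ℝ) (hσ : 0 < σ2) (hs2 : 0 < s2) (hs : s2 < s1)
    (P : ℝ) (hP : 0 < P) :
    StrictConcaveOn ℝ (Set.Icc (0:ℝ) ((1/2) * Real.logb 2 (1 + s2 * P / σ2)))
      (fun r => h1 σ2 s1 s2 P r) := by
  have hs1 : 0 < s1 := hs2.trans hs
  have hQ : 0 < P * s2 + σ2 := by positivity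
  have hlog : 0 < log 2 := log_pos one_lt_two
  have hpow : ∀ r : ℝ, (2 : ℝ) ^ (-(2 * r)) = exp (-(2 * log 2 * r)) := fun r => by
    rw [rpow_def_of_pos two_pos]
    ring_nf
  have harg : ∀ r : ℝ, 1 + s1 / (s2 * σ2) * ((P * s2 + σ2) * (2 : ℝ) ^ (-(2 * r)) - σ2) =
      s1 / (s2 * σ2) * (P * s2 + σ2) * exp (-(2 * log 2 * r)) - (s1 / s2 - 1) := fun r => by
    rw [hpow]
    field_simp
    ring
  have hconc := strictConcaveOn_log_mul_exp_neg_sub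
    (A := s1 / (s2 * σ2) * (P * s2 + σ2)) (C := s1 / s2 - 1) (k := 2 * log 2)
    (by positivity) (sub_pos.2 ((one_lt_div hs2).2 hs)) (by positivity)
    (convex_Icc (0 : ℝ) ((1 / 2) * logb 2 (1 + s2 * P / σ2))) (fun r hr => by
      have hle : (2 : ℝ) ^ (2 * r) ≤ 1 + s2 * P / σ2 :=
        (le_logb_iff_rpow_le one_lt_two (by positivity)).1 (by linarith [hr.2])
      have hnoise : σ2 ≤ (P * s2 + σ2) * (2 : ℝ) ^ (-(2 * r)) := by
        rw [rpow_neg two_pos.le, ← div_eq_mul_inv, le_div_iff₀ (by positivity)]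
        calc σ2 * (2 : ℝ) ^ (2 * r) ≤ σ2 * (1 + s2 * P / σ2) := by gcongr
          _ = P * s2 + σ2 := by field_simp; ring
      rw [← harg]
      have := mul_nonneg (by positivity : 0 ≤ s1 / (s2 * σ2)) (sub_nonneg.2 hnoise)
      linarith)
  have hscale : 0 < 1 / (2 * log 2) := by positivity
  refine ⟨hconc.1, fun x hx y hy hxy a b ha hb hab => ?_⟩
  have hlt := mul_lt_mul_of_pos_left (hconc.2 hx hy hxy ha hb hab) hscale
  have hh1 : ∀ r, h1 σ2 s1 s2 P r = 1 / (2 * log 2) *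
      log (s1 / (s2 * σ2) * (P * s2 + σ2) * exp (-(2 * log 2 * r)) - (s1 / s2 - 1)) := fun r => by
    rw [h1, harg, logb]
    field_simp
  simp only [hh1, smul_eq_mul] at hlt ⊢
  linarith
end

section
/- The rate function h₁ is supermodular: for all total powers 0 ≤ P ≤ P' and all weaker-user rates 0 ≤ r ≤ r' ≤ (1/2)·log₂(1 + s₂·P/σ²), one has h₁(P', r') − h₁(P, r') ≥ h₁(P', r) − h₁(P, r). -/
open Real Set

/-- If `r` is at most the weaker user's capacity at power `P`, the argument of the logarithm
in `h1` is at least `1`. -/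
theorem one_le_h1_arg {σ2 s1 s2 P r : ℝ} (hσ : 0 < σ2) (hs1 : 0 < s1) (hs2 : 0 < s2)
    (hP : 0 ≤ P) (hr : r ≤ (1/2) * Real.logb 2 (1 + s2 * P / σ2)) :
    1 ≤ 1 + (s1 / (s2 * σ2)) * ((P * s2 + σ2) * (2:ℝ) ^ (-(2*r)) - σ2) := by
  have hpos : 0 < 1 + s2 * P / σ2 := by positivity
  have hpow : (2:ℝ) ^ (2*r) ≤ 1 + s2 * P / σ2 :=
    (Real.le_logb_iff_rpow_le one_lt_two hpos).1 (by linarith)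
  have hsum : σ2 * (1 + s2 * P / σ2) = P * s2 + σ2 := by
    field_simp
    ring
  have hnoise : σ2 ≤ (P * s2 + σ2) * (2:ℝ) ^ (-(2*r)) := by
    rw [Real.rpow_neg zero_le_two, ← div_eq_mul_inv, le_div_iff₀ (by positivity), ← hsum]
    gcongr
  have hgain : 0 ≤ s1 / (s2 * σ2) := by positivity
  linarith [mul_nonneg hgain (sub_nonneg.2 hnoise)]

/-- The affine function `t ↦ 1 + c * (t - σ)` evaluated at products has increasing ratios when
`1 ≤ c * σ`. -/
theorem affine_mul_le_affine_mul {c σ Q Q' x x' : ℝ} (hc : 0 ≤ c) (hcσ : 1 ≤ c * σ)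
    (hQ : Q ≤ Q') (hx : x' ≤ x) :
    (1 + c * (Q' * x - σ)) * (1 + c * (Q * x' - σ)) ≤
      (1 + c * (Q' * x' - σ)) * (1 + c * (Q * x - σ)) := by
  have := mul_nonneg (mul_nonneg (sub_nonneg.2 hcσ) hc)
    (mul_nonneg (sub_nonneg.2 hQ) (sub_nonneg.2 hx))
  linarith

/-- `h1` is supermodular: the discrete monotone-differences inequality, formalizing
`∂²h₁/∂r∂P ≥ 0`. -/
theorem h1_supermodular (σ2 s1 s2 : ℝ) (hσ : 0 < σ2) (hs2 : 0 < s2) (hs : s2 < s1) :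
    ∀ P P' r r' : ℝ, 0 ≤ P → P ≤ P' → 0 ≤ r → r ≤ r' →
      r' ≤ (1/2) * Real.logb 2 (1 + s2 * P / σ2) →
      h1 σ2 s1 s2 P' r' - h1 σ2 s1 s2 P r' ≥ h1 σ2 s1 s2 P' r - h1 σ2 s1 s2 P r := by
  intro P P' r r' hP hPP' _ hrr' hr'
  have hs1 : 0 < s1 := hs2.trans hs
  have hP' : 0 ≤ P' := hP.trans hPP'
  have hcap : (1/2) * Real.logb 2 (1 + s2 * P / σ2) ≤ (1/2) * Real.logb 2 (1 + s2 * P' / σ2) := by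
    have : Real.logb 2 (1 + s2 * P / σ2) ≤ Real.logb 2 (1 + s2 * P' / σ2) :=
      Real.logb_le_logb_of_le one_lt_two (by positivity) (by gcongr)
    linarith
  have h₁ := zero_lt_one.trans_le (one_le_h1_arg hσ hs1 hs2 hP hr')
  have h₂ := zero_lt_one.trans_le (one_le_h1_arg hσ hs1 hs2 hP (hrr'.trans hr'))
  have h₃ := zero_lt_one.trans_le (one_le_h1_arg hσ hs1 hs2 hP' (hr'.trans hcap))
  have h₄ := zero_lt_one.trans_le (one_le_h1_arg hσ hs1 hs2 hP' (hrr'.trans (hr'.trans hcap)))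
  have hcσ : 1 ≤ s1 / (s2 * σ2) * σ2 := by
    rw [div_mul_eq_mul_div, le_div_iff₀ (by positivity), one_mul]
    gcongr
  have hx : (2:ℝ) ^ (-(2*r')) ≤ (2:ℝ) ^ (-(2*r)) :=
    Real.rpow_le_rpow_of_exponent_le one_le_two (by linarith)
  have hQ : P * s2 + σ2 ≤ P' * s2 + σ2 := by gcongr
  have hlog := Real.logb_le_logb_of_le one_lt_two (mul_pos h₄ h₁)
    (affine_mul_le_affine_mul (by positivity) hcσ hQ hx)
  rw [Real.logb_mul h₄.ne' h₁.ne', Real.logb_mul h₃.ne' h₂.ne'] at hlog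
  unfold h1
  linarith
end

section
/- The rate functions h₁ and h₂ are inverse to each other at each fixed total power: for every P ≥ 0, (i) if 0 ≤ r ≤ (1/2)·log₂(1 + s₁·P/σ²) then h₁(P, h₂(P, r)) = r, and (ii) if 0 ≤ r ≤ (1/2)·log₂(1 + s₂·P/σ²) then h₂(P, h₁(P, r)) = r. (This expresses that each user's boundary rate can be written as a function of the other user's rate and the total power, r₁ = h₁(P, r₂) and r₂ = h₂(P, r₁).) -/
open Real Set

/-- The weaker user's rate on the two-user AWGN BC, as a function of total power `P`
and the stronger user's rate `r`. -/
noncomputable def h2 (σ2 s1 s2 P r : ℝ) : ℝ :=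
  (1/2) * Real.logb 2 ((P * s2 + σ2) / ((σ2 * s2 / s1) * ((2:ℝ) ^ (2*r) - 1) + σ2))

lemma two_rpow_two_mul_half_logb {x : ℝ} (hx : 0 < x) :
    (2:ℝ) ^ (2 * ((1/2) * Real.logb 2 x)) = x := by
  rw [← mul_assoc, show (2:ℝ) * (1/2) = 1 by norm_num, one_mul,
    Real.rpow_logb two_pos (by norm_num) hx]

lemma half_logb_two_rpow_two_mul (r : ℝ) : (1/2) * Real.logb 2 ((2:ℝ) ^ (2 * r)) = r := by
  rw [Real.logb_rpow two_pos (by norm_num)]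
  ring

/-- At each fixed total power, `h1` and `h2` are inverse to each other on the
respective admissible rate ranges. -/
theorem h1_h2_inverse (σ2 s1 s2 : ℝ) (hσ : 0 < σ2) (hs2 : 0 < s2) (hs : s2 < s1) :
    ∀ P, 0 ≤ P →
      (∀ r, 0 ≤ r → r ≤ (1/2) * Real.logb 2 (1 + s1 * P / σ2) →
        h1 σ2 s1 s2 P (h2 σ2 s1 s2 P r) = r) ∧
      (∀ r, 0 ≤ r → r ≤ (1/2) * Real.logb 2 (1 + s2 * P / σ2) →
        h2 σ2 s1 s2 P (h1 σ2 s1 s2 P r) = r) := by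
  intro P hP
  have hs1 : 0 < s1 := hs2.trans hs
  have hN : 0 < P * s2 + σ2 := by positivity
  refine ⟨fun r hr _ => ?_, fun r _ hr => ?_⟩
  · have ht : 1 ≤ (2:ℝ) ^ (2 * r) := Real.one_le_rpow one_le_two (by positivity)
    have hD : 0 < (σ2 * s2 / s1) * ((2:ℝ) ^ (2*r) - 1) + σ2 :=
      add_pos_of_nonneg_of_pos (mul_nonneg (by positivity) (sub_nonneg.2 ht)) hσ
    unfold h1 h2
    rw [Real.rpow_neg two_pos.le, two_rpow_two_mul_half_logb (div_pos hN hD), inv_div,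
      mul_div_cancel₀ _ hN.ne']
    convert half_logb_two_rpow_two_mul r using 3
    field_simp
    ring
  · have ht : 0 < (2:ℝ) ^ (2 * r) := Real.rpow_pos_of_pos two_pos _
    have hle : (2:ℝ) ^ (2 * r) ≤ 1 + s2 * P / σ2 := by
      rw [← two_rpow_two_mul_half_logb (show 0 < 1 + s2 * P / σ2 by positivity)]
      exact Real.rpow_le_rpow_of_exponent_le one_le_two (by linarith)
    have hσN : σ2 ≤ (P * s2 + σ2) * ((2:ℝ) ^ (2 * r))⁻¹ := by
      rw [← div_eq_mul_inv, le_div_iff₀ ht]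
      calc σ2 * (2:ℝ) ^ (2 * r) ≤ σ2 * (1 + s2 * P / σ2) := by gcongr
        _ = P * s2 + σ2 := by field_simp; ring
    unfold h1 h2
    rw [Real.rpow_neg two_pos.le, two_rpow_two_mul_half_logb
      (add_pos_of_pos_of_nonneg one_pos (mul_nonneg (by positivity) (sub_nonneg.2 hσN)))]
    convert half_logb_two_rpow_two_mul r using 3
    have hD : (σ2 * s2 / s1) * (1 + (s1 / (s2 * σ2)) *
        ((P * s2 + σ2) * ((2:ℝ) ^ (2 * r))⁻¹ - σ2) - 1) + σ2 =
        (P * s2 + σ2) * ((2:ℝ) ^ (2 * r))⁻¹ := by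
      field_simp
      ring
    rw [hD]
    field_simp
end

section
/- Bringing two consecutive power levels closer (transferring energy forward in time while keeping each slot's stronger-user rate fixed) cannot decrease the time-averaged rate of the weaker user: for all powers 0 ≤ P₂ ≤ P₁, every transfer amount 0 ≤ ΔP ≤ P₁ − P₂, every time fraction β ∈ [0, 1], and all stronger-user rates r_a, r_b ≥ 0, setting P₁' = P₁ − (1 − β)·ΔP and P₂' = P₂ + β·ΔP, one has β·h₂(P₁', r_a) + (1 − β)·h₂(P₂', r_b) ≥ β·h₂(P₁, r_a) + (1 − β)·h₂(P₂, r_b). (This is the key inequality in the proof of Lemma 2, showing power is nondecreasing in an optimal schedule.) -/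
open Real Set

/-- Moving two points of a concave function towards each other, with displacements that preserve
their weighted mean, does not decrease the weighted mean of the values. -/
theorem ConcaveOn.weighted_mean_le_of_contract {s : Set ℝ} {f : ℝ → ℝ} (hf : ConcaveOn ℝ s f)
    {x y t β : ℝ} (hx : x ∈ s) (hy : y ∈ s) (ht : t ∈ Set.Icc (0 : ℝ) 1)
    (hβ : β ∈ Set.Icc (0 : ℝ) 1) :
    β * f x + (1 - β) * f y ≤
      β * f (x - (1 - β) * (t * (x - y))) + (1 - β) * f (y + β * (t * (x - y))) := by
  obtain ⟨ht0, ht1⟩ := ht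
  obtain ⟨hβ0, hβ1⟩ := hβ
  have hβ' : 0 ≤ 1 - β := sub_nonneg.2 hβ1
  have hfx := hf.2 hx hy (show 0 ≤ 1 - (1 - β) * t by nlinarith)
    (show 0 ≤ (1 - β) * t by positivity) (by ring)
  have hfy := hf.2 hx hy (show 0 ≤ β * t by positivity)
    (show 0 ≤ 1 - β * t by nlinarith) (by ring)
  simp only [smul_eq_mul] at hfx hfy
  rw [show (1 - (1 - β) * t) * x + (1 - β) * t * y = x - (1 - β) * (t * (x - y)) by ring] at hfx
  rw [show β * t * x + (1 - β * t) * y = y + β * (t * (x - y)) by ring] at hfy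
  linarith [mul_le_mul_of_nonneg_left hfx hβ0, mul_le_mul_of_nonneg_left hfy hβ']

theorem h2_eq_sub_log {σ2 s1 s2 P r : ℝ} (hσ : 0 < σ2) (hs1 : 0 < s1) (hs2 : 0 < s2)
    (hP : 0 ≤ P) (hr : 0 ≤ r) :
    h2 σ2 s1 s2 P r = (Real.log (P * s2 + σ2) -
      Real.log ((σ2 * s2 / s1) * ((2 : ℝ) ^ (2 * r) - 1) + σ2)) / (2 * Real.log 2) := by
  have hpow : 0 ≤ (2 : ℝ) ^ (2 * r) - 1 :=
    sub_nonneg.2 (Real.one_le_rpow one_le_two (by positivity))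
  rw [h2, Real.logb, Real.log_div (by positivity) (by positivity)]
  ring

/-- Bringing two consecutive power levels closer, keeping each slot's stronger-user
rate fixed, cannot decrease the time-averaged rate of the weaker user (key inequality
in the proof of Lemma 2). -/
theorem h2_closer_powers (σ2 s1 s2 : ℝ) (hσ : 0 < σ2) (hs2 : 0 < s2) (hs : s2 < s1)
    (P1 P2 ΔP β ra rb : ℝ)
    (hP2 : 0 ≤ P2) (hP21 : P2 ≤ P1) (hΔ0 : 0 ≤ ΔP) (hΔ : ΔP ≤ P1 - P2)
    (hβ : β ∈ Set.Icc (0:ℝ) 1) (hra : 0 ≤ ra) (hrb : 0 ≤ rb) :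
    β * h2 σ2 s1 s2 (P1 - (1 - β) * ΔP) ra
      + (1 - β) * h2 σ2 s1 s2 (P2 + β * ΔP) rb ≥
    β * h2 σ2 s1 s2 P1 ra + (1 - β) * h2 σ2 s1 s2 P2 rb := by
  obtain ⟨hβ0, hβ1⟩ := hβ
  have hs1 : 0 < s1 := hs2.trans hs
  have hP1 : 0 ≤ P1 := hP2.trans hP21
  obtain ⟨t, ht, rfl⟩ : ∃ t ∈ Set.Icc (0 : ℝ) 1, ΔP = t * (P1 - P2) := by
    rcases hP21.eq_or_lt with rfl | hlt
    · exact ⟨0, by simp, by linarith⟩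
    · have hD : 0 < P1 - P2 := sub_pos.2 hlt
      exact ⟨ΔP / (P1 - P2), ⟨by positivity, (div_le_one hD).2 hΔ⟩, by field_simp⟩
  have hP1' : 0 ≤ P1 - (1 - β) * (t * (P1 - P2)) := by
    nlinarith [mul_nonneg hβ0 hΔ0]
  have hP2' : 0 ≤ P2 + β * (t * (P1 - P2)) := by positivity
  have hmean := strictConcaveOn_log_Ioi.concaveOn.weighted_mean_le_of_contract
    (x := P1 * s2 + σ2) (y := P2 * s2 + σ2) (Set.mem_Ioi.2 (by positivity))
    (Set.mem_Ioi.2 (by positivity)) ht ⟨hβ0, hβ1⟩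
  rw [show P1 * s2 + σ2 - (1 - β) * (t * (P1 * s2 + σ2 - (P2 * s2 + σ2))) =
      (P1 - (1 - β) * (t * (P1 - P2))) * s2 + σ2 by ring,
    show P2 * s2 + σ2 + β * (t * (P1 * s2 + σ2 - (P2 * s2 + σ2))) =
      (P2 + β * (t * (P1 - P2))) * s2 + σ2 by ring] at hmean
  rw [h2_eq_sub_log hσ hs1 hs2 hP1' hra, h2_eq_sub_log hσ hs1 hs2 hP2' hrb,
    h2_eq_sub_log hσ hs1 hs2 hP1 hra, h2_eq_sub_log hσ hs1 hs2 hP2 hrb, ge_iff_le]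
  simp only [← mul_div_assoc, ← add_div]
  gcongr ?_ / _
  linarith
end

section
/- Bringing two consecutive power levels closer (keeping each slot's weaker-user rate fixed) cannot decrease the time-averaged rate of the stronger user, provided the first slot's weaker-user rate does not exceed the second's: for all powers 0 ≤ P₂ ≤ P₁, every transfer amount 0 ≤ ΔP ≤ P₁ − P₂, every β ∈ [0, 1], and all weaker-user rates with 0 ≤ r_a ≤ r_b ≤ (1/2)·log₂(1 + s₂·P₂/σ²), setting P₁' = P₁ − (1 − β)·ΔP and P₂' = P₂ + β·ΔP, one has β·h₁(P₁', r_a) + (1 − β)·h₁(P₂', r_b) ≥ β·h₁(P₁, r_a) + (1 − β)·h₁(P₂, r_b). Equivalently, the function q(β) = β·h₁(P₁ − (1−β)·ΔP, r_a) + (1−β)·h₁(P₂ + β·ΔP, r_b) − β·h₁(P₁, r_a) − (1−β)·h₁(P₂, r_b) is concave in β on [0,1] with q(0) = q(1) = 0, hence nonnegative. (This is the second key inequality in the proof of Lemma 2.) -/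
open Real Set

/-- The affine-weighted sum of logarithms of two nondecreasing affine functions is concave on the
unit interval when the first one has the smaller logarithmic derivative. -/
theorem concaveOn_mul_log_add_one_sub_mul_log {p q e f : ℝ} (hp : 0 < p) (hq : 0 < q)
    (he : 0 ≤ e) (hf : 0 ≤ f) (h : e * q ≤ f * p) :
    ConcaveOn ℝ (Icc (0 : ℝ) 1)
      (fun b => b * log (p + e * b) + (1 - b) * log (q + f * b)) := by
  have hpos {c d b : ℝ} (hc : 0 < c) (hd : 0 ≤ d) (hb : 0 ≤ b) : 0 < c + d * b := by positivity
  have hlin (c d b : ℝ) : HasDerivAt (fun b => c + d * b) d b := by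
    simpa using ((hasDerivAt_id b).const_mul d).const_add c
  have hsub (b : ℝ) : HasDerivAt (fun b : ℝ => 1 - b) (-1) b := by
    simpa using (hasDerivAt_id b).const_sub 1
  have hdiv {c d b : ℝ} (hne : c + d * b ≠ 0) :
      HasDerivAt (fun b => d / (c + d * b)) (-(d / (c + d * b)) ^ 2) b :=
    ((hasDerivAt_const b d).div (hlin c d b) hne).congr_deriv (by rw [div_pow]; ring)
  refine concaveOn_of_hasDerivWithinAt2_nonpos (convex_Icc 0 1)
    (f' := fun b => log (p + e * b) - log (q + f * b)
      + b * (e / (p + e * b)) + (1 - b) * (f / (q + f * b)))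
    (f'' := fun b => 2 * (e / (p + e * b) - f / (q + f * b))
      - b * (e / (p + e * b)) ^ 2 - (1 - b) * (f / (q + f * b)) ^ 2) ?_ ?_ ?_ ?_
  · intro b hb
    have hu := hpos hp he hb.1
    have hv := hpos hq hf hb.1
    exact (((hasDerivAt_id b).mul ((hlin p e b).log hu.ne')).add
      ((hsub b).mul ((hlin q f b).log hv.ne'))).continuousAt.continuousWithinAt
  · intro b hb
    rw [interior_Icc] at hb
    have hu := hpos hp he hb.1.le
    have hv := hpos hq hf hb.1.le
    refine ((((hasDerivAt_id b).mul ((hlin p e b).log hu.ne')).add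
      ((hsub b).mul ((hlin q f b).log hv.ne'))).congr_deriv ?_).hasDerivWithinAt
    simp only [id]
    ring
  · intro b hb
    rw [interior_Icc] at hb
    have hu := hpos hp he hb.1.le
    have hv := hpos hq hf hb.1.le
    refine ((((((hlin p e b).log hu.ne').sub ((hlin q f b).log hv.ne')).add
      ((hasDerivAt_id b).mul (hdiv hu.ne'))).add
      ((hsub b).mul (hdiv hv.ne'))).congr_deriv
        ?_).hasDerivWithinAt
    simp only [id]
    ring
  · intro b hb
    rw [interior_Icc] at hb
    have hu := hpos hp he hb.1.le
    have hv := hpos hq hf hb.1.le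
    have hle : e / (p + e * b) ≤ f / (q + f * b) := by
      rw [div_le_div_iff₀ hu hv]
      linarith
    have hsq_e := mul_nonneg hb.1.le (sq_nonneg (e / (p + e * b)))
    have hsq_f := mul_nonneg (sub_nonneg.2 hb.2.le) (sq_nonneg (f / (q + f * b)))
    linarith

/-- A rate within the weaker user's single-user capacity leaves at least the noise power. -/
theorem le_mul_two_rpow_of_le_half_logb {σ2 s2 P r : ℝ} (hσ : 0 < σ2) (hs2 : 0 < s2) (hP : 0 ≤ P)
    (hr : r ≤ (1/2) * Real.logb 2 (1 + s2 * P / σ2)) :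
    σ2 ≤ (P * s2 + σ2) * (2 : ℝ) ^ (-(2 * r)) := by
  have hpow : (2 : ℝ) ^ (2 * r) ≤ 1 + s2 * P / σ2 := by
    rw [← Real.le_logb_iff_rpow_le one_lt_two (by positivity)]
    linarith
  rw [Real.rpow_neg zero_le_two, ← div_eq_mul_inv, le_div_iff₀ (by positivity)]
  calc σ2 * 2 ^ (2 * r) ≤ σ2 * (1 + s2 * P / σ2) := by gcongr
    _ = P * s2 + σ2 := by field_simp; ring

/-- Bringing two consecutive power levels closer, keeping each slot's weaker-user
rate fixed, cannot decrease the time-averaged rate of the stronger user, provided the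
first slot's weaker-user rate does not exceed the second's.  Equivalently, the
function `q(β)` is concave on `[0,1]` with `q 0 = q 1 = 0`, hence nonnegative
(second key inequality in the proof of Lemma 2). -/
theorem h1_closer_powers (σ2 s1 s2 : ℝ) (hσ : 0 < σ2) (hs2 : 0 < s2) (hs : s2 < s1)
    (P1 P2 ΔP β ra rb : ℝ)
    (hP2 : 0 ≤ P2) (hP21 : P2 ≤ P1) (hΔ0 : 0 ≤ ΔP) (hΔ : ΔP ≤ P1 - P2)
    (hβ : β ∈ Set.Icc (0:ℝ) 1)
    (hra : 0 ≤ ra) (hrab : ra ≤ rb)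
    (hrb : rb ≤ (1/2) * Real.logb 2 (1 + s2 * P2 / σ2)) :
    (β * h1 σ2 s1 s2 (P1 - (1 - β) * ΔP) ra
        + (1 - β) * h1 σ2 s1 s2 (P2 + β * ΔP) rb ≥
      β * h1 σ2 s1 s2 P1 ra + (1 - β) * h1 σ2 s1 s2 P2 rb) ∧
    ConcaveOn ℝ (Set.Icc (0:ℝ) 1)
      (fun b => b * h1 σ2 s1 s2 (P1 - (1 - b) * ΔP) ra
        + (1 - b) * h1 σ2 s1 s2 (P2 + b * ΔP) rb
        - b * h1 σ2 s1 s2 P1 ra - (1 - b) * h1 σ2 s1 s2 P2 rb) ∧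
    (fun b => b * h1 σ2 s1 s2 (P1 - (1 - b) * ΔP) ra
        + (1 - b) * h1 σ2 s1 s2 (P2 + b * ΔP) rb
        - b * h1 σ2 s1 s2 P1 ra - (1 - b) * h1 σ2 s1 s2 P2 rb) 0 = 0 ∧
    (fun b => b * h1 σ2 s1 s2 (P1 - (1 - b) * ΔP) ra
        + (1 - b) * h1 σ2 s1 s2 (P2 + b * ΔP) rb
        - b * h1 σ2 s1 s2 P1 ra - (1 - b) * h1 σ2 s1 s2 P2 rb) 1 = 0 := by
  have hconc : ConcaveOn ℝ (Set.Icc (0:ℝ) 1)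
      (fun b => b * h1 σ2 s1 s2 (P1 - (1 - b) * ΔP) ra
        + (1 - b) * h1 σ2 s1 s2 (P2 + b * ΔP) rb
        - b * h1 σ2 s1 s2 P1 ra - (1 - b) * h1 σ2 s1 s2 P2 rb) := by
    have hB := le_mul_two_rpow_of_le_half_logb hσ hs2 hP2 hrb
    have hB0 : (0 : ℝ) < 2 ^ (-(2 * rb)) := by positivity
    have hBA : (2 : ℝ) ^ (-(2 * rb)) ≤ 2 ^ (-(2 * ra)) :=
      Real.rpow_le_rpow_of_exponent_le one_le_two (by linarith)
    have hs1 : 0 < s1 := hs2.trans hs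
    have hk : 0 < s1 / (s2 * σ2) := by positivity
    have hkσ : 1 ≤ s1 / (s2 * σ2) * σ2 := by
      rw [div_mul_eq_mul_div, le_div_iff₀ (by positivity)]
      nlinarith
    unfold h1
    generalize (2 : ℝ) ^ (-(2 * rb)) = B at *
    generalize (2 : ℝ) ^ (-(2 * ra)) = A at *
    generalize s1 / (s2 * σ2) = k at *
    have hA : σ2 ≤ ((P1 - ΔP) * s2 + σ2) * A :=
      hB.trans (mul_le_mul (by gcongr; linarith) hBA hB0.le (by nlinarith))
    have hA0 : 0 < A := hB0.trans_le hBA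
    have hcross : k * s2 * A * ΔP * (1 + k * ((P2 * s2 + σ2) * B - σ2)) ≤
        k * s2 * B * ΔP * (1 + k * (((P1 - ΔP) * s2 + σ2) * A - σ2)) := by
      have hc : A * (1 + k * ((P2 * s2 + σ2) * B - σ2)) ≤
          B * (1 + k * (((P1 - ΔP) * s2 + σ2) * A - σ2)) := by
        have hgap : 0 ≤ k * s2 * A * B * (P1 - P2 - ΔP) :=
          mul_nonneg (by positivity) (by linarith)
        have hoff := mul_nonneg (sub_nonneg.2 hBA) (sub_nonneg.2 hkσ)
        linarith
      have hm := mul_le_mul_of_nonneg_left hc (by positivity : 0 ≤ k * s2 * ΔP)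
      linarith
    have hlog := concaveOn_mul_log_add_one_sub_mul_log
      (p := 1 + k * (((P1 - ΔP) * s2 + σ2) * A - σ2)) (q := 1 + k * ((P2 * s2 + σ2) * B - σ2))
      (e := k * s2 * A * ΔP) (f := k * s2 * B * ΔP)
      (by have := mul_nonneg hk.le (sub_nonneg.2 hA); linarith)
      (by have := mul_nonneg hk.le (sub_nonneg.2 hB); linarith)
      (by positivity) (by positivity) hcross
    have hlog2 : 0 < log 2 := log_pos one_lt_two
    have hscaled := hlog.smul (by positivity : 0 ≤ 1 / 2 * (log 2)⁻¹)
    generalize 1 / 2 * logb 2 (1 + k * ((P1 * s2 + σ2) * A - σ2)) = C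
    generalize 1 / 2 * logb 2 (1 + k * ((P2 * s2 + σ2) * B - σ2)) = D
    have haff : ConcaveOn ℝ (Icc (0 : ℝ) 1) (fun b => (D - C) * b - D) :=
      ⟨convex_Icc 0 1, fun x _ y _ a b _ _ hab => by
        obtain rfl : b = 1 - a := by linarith
        simp only [smul_eq_mul]
        linarith⟩
    refine (hscaled.add haff).congr fun b _ => ?_
    have hu : 1 + k * (((P1 - (1 - b) * ΔP) * s2 + σ2) * A - σ2) =
        1 + k * (((P1 - ΔP) * s2 + σ2) * A - σ2) + k * s2 * A * ΔP * b := by ring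
    have hv : 1 + k * (((P2 + b * ΔP) * s2 + σ2) * B - σ2) =
        1 + k * ((P2 * s2 + σ2) * B - σ2) + k * s2 * B * ΔP * b := by ring
    simp only [hu, hv, logb, div_eq_mul_inv, Pi.add_apply, smul_eq_mul]
    ring
  refine ⟨?_, hconc, by simp, by simp⟩
  have h := hconc.2 (left_mem_Icc.2 zero_le_one) (right_mem_Icc.2 zero_le_one)
    (sub_nonneg.2 hβ.2) hβ.1 (sub_add_cancel 1 β)
  simp at h
  linarith
end

section
/- The function F is strictly concave on (0, ∞). (This corresponds to the paper's computation that ∂²B₂/∂T₂² = −1/(2·ln 2·(T₁+T₂)·(1 + (σ²/s₂)·(T₁+T₂)/E)²) − 2·ln 2·B₁₂²·((s₁−s₂)/s₂)·2^{−2B₁₂/T₂} / (T₂³·(1 + ((s₁−s₂)/s₂)·2^{−2B₁₂/T₂})²) < 0 for s₁ > s₂.) -/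
open Real Set

/-- `F T₂` is the number of bits deliverable to the weaker user of a two-user AWGN BC
in time `T₁ + T₂` when `B₁₁` and `B₁₂` bits are delivered to the stronger user in the
respective epochs and the energy `E` is spread uniformly over `[0, T₁+T₂]`. -/
noncomputable def F (σ2 s1 s2 T1 E B11 B12 T2 : ℝ) : ℝ :=
  ((T1 + T2) / 2) * Real.logb 2 (E / (T1 + T2) + σ2 / s2)
  - (T1 / 2) * Real.logb 2 ((σ2 / s1) * ((2:ℝ) ^ (2 * B11 / T1) - 1) + σ2 / s2)
  - (T2 / 2) * Real.logb 2 ((σ2 / s1) * ((2:ℝ) ^ (2 * B12 / T2) - 1) + σ2 / s2)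

lemma StrictConcaveOn.perspective {f : ℝ → ℝ} (hf : StrictConcaveOn ℝ (Ioi 0) f) :
    StrictConcaveOn ℝ (Ioi 0) fun t ↦ t * f t⁻¹ := by
  refine ⟨convex_Ioi 0, fun x hx y hy hxy a b ha hb hab ↦ ?_⟩
  simp only [mem_Ioi, smul_eq_mul] at *
  have hu : 0 < a * x + b * y := by positivity
  have h := hf.2 (inv_pos.2 hx) (inv_pos.2 hy) (inv_injective.ne hxy)
    (show 0 < a * x / (a * x + b * y) by positivity)
    (show 0 < b * y / (a * x + b * y) by positivity) (by field_simp)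
  have hmean : a * x / (a * x + b * y) * x⁻¹ + b * y / (a * x + b * y) * y⁻¹
      = (a * x + b * y)⁻¹ := by
    field_simp
    exact hab
  simp only [smul_eq_mul, hmean] at h
  convert mul_lt_mul_of_pos_left h hu using 1
  field_simp

lemma ConvexOn.perspective {f : ℝ → ℝ} (hf : ConvexOn ℝ (Ioi 0) f) :
    ConvexOn ℝ (Ioi 0) fun t ↦ t * f t⁻¹ := by
  refine ⟨convex_Ioi 0, fun x hx y hy a b ha hb hab ↦ ?_⟩
  have hu : 0 < a * x + b * y := (convex_Ioi (0 : ℝ)) hx hy ha hb hab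
  simp only [mem_Ioi, smul_eq_mul] at *
  have h := hf.2 (inv_pos.2 hx) (inv_pos.2 hy)
    (show 0 ≤ a * x / (a * x + b * y) by positivity)
    (show 0 ≤ b * y / (a * x + b * y) by positivity) (by field_simp)
  have hmean : a * x / (a * x + b * y) * x⁻¹ + b * y / (a * x + b * y) * y⁻¹
      = (a * x + b * y)⁻¹ := by
    field_simp
    exact hab
  simp only [smul_eq_mul, hmean] at h
  convert mul_le_mul_of_nonneg_left h hu.le using 1
  field_simp

lemma strictConcaveOn_log_affine {c k : ℝ} (hc : 0 < c) (hk : 0 < k) :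
    StrictConcaveOn ℝ (Ioi 0) fun v ↦ Real.log (c * v + k) := by
  refine ⟨convex_Ioi 0, fun x hx y hy hxy a b ha hb hab ↦ ?_⟩
  simp only [mem_Ioi, smul_eq_mul] at *
  have h := strictConcaveOn_log_Ioi.2 (show 0 < c * x + k by positivity)
    (show 0 < c * y + k by positivity) (by simpa [hc.ne'] using hxy) ha hb hab
  simp only [smul_eq_mul] at h
  convert h using 2
  linear_combination -k * hab

lemma convexOn_log_mul_exp_add {a d : ℝ} (b : ℝ) (ha : 0 < a) (hd : 0 < d) :
    ConvexOn ℝ univ fun v ↦ Real.log (a * Real.exp (b * v) + d) := by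
  have hpos (v : ℝ) : 0 < a * Real.exp (b * v) + d := by positivity
  have hderiv (v : ℝ) : HasDerivAt (fun v ↦ Real.log (a * Real.exp (b * v) + d))
      (a * (Real.exp (b * v) * b) / (a * Real.exp (b * v) + d)) v := by
    have := ((((hasDerivAt_id v).const_mul b).exp.const_mul a).add_const d).log (hpos v).ne'
    simpa using this
  refine Monotone.convexOn_univ_of_deriv (fun v ↦ (hderiv v).differentiableAt) ?_
  intro x y hxy
  rw [(hderiv x).deriv, (hderiv y).deriv, div_le_div_iff₀ (hpos x) (hpos y)]
  have key : b * Real.exp (b * x) ≤ b * Real.exp (b * y) := by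
    rcases le_total 0 b with hb | hb
    · gcongr
    · exact mul_le_mul_of_nonpos_left
        (Real.exp_le_exp.2 (mul_le_mul_of_nonpos_left hxy hb)) hb
  linear_combination a * d * key

/-- `F` is strictly concave on `(0, ∞)`. -/
theorem F_strictConcaveOn (σ2 s1 s2 T1 E B11 B12 : ℝ)
    (hσ : 0 < σ2) (hs2 : 0 < s2) (hs : s2 < s1) (hT1 : 0 < T1) (hE : 0 < E)
    (hB11 : 0 ≤ B11) (hB12 : 0 < B12) :
    StrictConcaveOn ℝ (Set.Ioi (0:ℝ)) (F σ2 s1 s2 T1 E B11 B12) := by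
  have hs1 : 0 < s1 := hs2.trans hs
  have hd : 0 < σ2 / s2 - σ2 / s1 := sub_pos.2 (div_lt_div_of_pos_left hσ hs2 hs)
  have hlog : 0 < Real.log 2 := Real.log_pos one_lt_two
  have hweak := ((strictConcaveOn_log_affine hE
    (div_pos hσ hs2)).perspective.translate_right T1).subset
      (fun t (ht : t ∈ Ioi 0) ↦ add_pos hT1 ht) (convex_Ioi 0)
  have hstrong := ((convexOn_log_mul_exp_add (Real.log 2 * (2 * B12))
    (div_pos hσ hs1) hd).subset (subset_univ _) (convex_Ioi 0)).perspective
  have hsum := hweak.sub_convexOn hstrong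
  refine ⟨convex_Ioi 0, fun x hx y hy hxy a b ha hb hab ↦ ?_⟩
  set C := T1 / 2 * Real.logb 2 (σ2 / s1 * ((2:ℝ) ^ (2 * B11 / T1) - 1) + σ2 / s2)
  have hF (t : ℝ) : F σ2 s1 s2 T1 E B11 B12 t = (2 * Real.log 2)⁻¹ *
      (((fun u ↦ u * Real.log (E * u⁻¹ + σ2 / s2)) ∘ fun z ↦ T1 + z) t -
        t * Real.log (σ2 / s1 * Real.exp (Real.log 2 * (2 * B12) * t⁻¹)
          + (σ2 / s2 - σ2 / s1))) - C := by
    have harg : σ2 / s1 * ((2:ℝ) ^ (2 * B12 / t) - 1) + σ2 / s2 =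
        σ2 / s1 * Real.exp (Real.log 2 * (2 * B12) * t⁻¹) + (σ2 / s2 - σ2 / s1) := by
      rw [Real.rpow_def_of_pos two_pos, div_eq_mul_inv (2 * B12), ← mul_assoc (Real.log 2)]
      ring
    rw [F, harg]
    simp only [Function.comp_apply, Real.logb, C, div_eq_mul_inv, mul_inv]
    ring
  have h := mul_lt_mul_of_pos_left (hsum.2 hx hy hxy ha hb hab)
    (inv_pos.2 (mul_pos two_pos hlog))
  simp only [hF, smul_eq_mul, Pi.sub_apply] at h ⊢
  linear_combination h - C * hab
end

section
/- The function F has a finite limit as T₂ → ∞, namely lim_{T₂→∞} F(T₂) = E·s₂/(2·ln 2·σ²) − (s₂/s₁)·B₁₂ − (T₁/2)·log₂((s₂/s₁)·(2^{2B₁₁/T₁} − 1) + 1). In particular F is bounded above on (0, ∞). -/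
open Real Set Filter

/-- A function vanishing at `0` with derivative `d` there satisfies `x * h x⁻¹ → d` as `x → ∞`. -/
theorem HasDerivAt.tendsto_mul_comp_inv_atTop {h : ℝ → ℝ} {d : ℝ}
    (hd : HasDerivAt h d 0) (h0 : h 0 = 0) :
    Tendsto (fun x => x * h x⁻¹) atTop (nhds d) := by
  have hinv : Tendsto (fun x : ℝ => x⁻¹) atTop (nhdsWithin 0 {0}ᶜ) :=
    tendsto_inv_atTop_nhdsGT_zero.mono_right (nhdsWithin_mono 0 fun _ hx => ne_of_gt hx)
  simpa [Function.comp_def, h0] using (hasDerivAt_iff_tendsto_slope_zero.mp hd).comp hinv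

theorem tendsto_mul_logb_one_add_div_atTop (b a : ℝ) :
    Tendsto (fun x => x * Real.logb b (1 + a / x)) atTop (nhds (a / Real.log b)) := by
  have hlin : HasDerivAt (fun x : ℝ => 1 + a * x) a 0 := by
    simpa using ((hasDerivAt_id (0 : ℝ)).const_mul a).const_add 1
  have hlog : HasDerivAt (fun x : ℝ => Real.logb b (1 + a * x)) (a / Real.log b) 0 := by
    simpa [Real.logb] using (hlin.log (by simp)).div_const (Real.log b)
  simpa [div_eq_mul_inv] using hlog.tendsto_mul_comp_inv_atTop (by simp)

theorem tendsto_mul_logb_rpow_div_atTop {b : ℝ} (hb : 1 < b) (r a : ℝ) :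
    Tendsto (fun x => x * Real.logb b (r * (b ^ (a / x) - 1) + 1)) atTop (nhds (r * a)) := by
  have hb0 : 0 < b := one_pos.trans hb
  have hlogb : Real.log b ≠ 0 := (Real.log_pos hb).ne'
  have hlin : HasDerivAt (fun x : ℝ => a * x) a 0 := by
    simpa using (hasDerivAt_id (0 : ℝ)).const_mul a
  have harg : HasDerivAt (fun x : ℝ => r * (b ^ (a * x) - 1) + 1) (r * (Real.log b * a)) 0 := by
    simpa using (((hlin.const_rpow hb0).sub_const 1).const_mul r).add_const 1
  have hlog : HasDerivAt (fun x : ℝ => Real.logb b (r * (b ^ (a * x) - 1) + 1)) (r * a) 0 := by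
    have h := (harg.log (by simp)).div_const (Real.log b)
    simp only [mul_zero, Real.rpow_zero, sub_self, zero_add, div_one] at h
    rwa [mul_div_assoc, mul_div_cancel_left₀ a hlogb] at h
  simpa [div_eq_mul_inv] using hlog.tendsto_mul_comp_inv_atTop (by simp)

/-- The weights of the three logarithms in `F` cancel, so the common noise level `σ² / s₂`
can be factored out of them. -/
theorem F_eq_normalized {σ2 s1 s2 T1 E B11 B12 T2 : ℝ}
    (hσ : 0 < σ2) (hs1 : 0 < s1) (hs2 : 0 < s2) (hT1 : 0 < T1) (hE : 0 ≤ E)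
    (hB11 : 0 ≤ B11) (hB12 : 0 ≤ B12) (hT2 : 0 < T2) :
    F σ2 s1 s2 T1 E B11 B12 T2 =
      ((T1 + T2) * Real.logb 2 (1 + E * s2 / σ2 / (T1 + T2))) / 2
      - (T2 * Real.logb 2 ((s2 / s1) * ((2 : ℝ) ^ (2 * B12 / T2) - 1) + 1)) / 2
      - (T1 / 2) * Real.logb 2 ((s2 / s1) * ((2 : ℝ) ^ (2 * B11 / T1) - 1) + 1) := by
  have hT : 0 < T1 + T2 := by positivity
  have hc : σ2 / s2 ≠ 0 := by positivity
  have hpow {B T : ℝ} (hB : 0 ≤ B) (hT : 0 < T) :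
      Real.logb 2 ((σ2 / s1) * ((2 : ℝ) ^ (2 * B / T) - 1) + σ2 / s2) =
        Real.logb 2 (σ2 / s2) +
          Real.logb 2 ((s2 / s1) * ((2 : ℝ) ^ (2 * B / T) - 1) + 1) := by
    have hone : (0 : ℝ) ≤ (2 : ℝ) ^ (2 * B / T) - 1 :=
      sub_nonneg.mpr (Real.one_le_rpow one_le_two (by positivity))
    rw [← Real.logb_mul hc (by positivity)]
    congr 1
    field_simp
  have hen : Real.logb 2 (E / (T1 + T2) + σ2 / s2) =
      Real.logb 2 (σ2 / s2) + Real.logb 2 (1 + E * s2 / σ2 / (T1 + T2)) := by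
    rw [← Real.logb_mul hc (by positivity)]
    congr 1
    field_simp
    ring
  rw [F, hpow hB11 hT1, hpow hB12 hT2, hen]
  ring

/-- `F` has a finite limit as `T₂ → ∞`, namely
`E·s₂/(2·ln 2·σ²) − (s₂/s₁)·B₁₂ − (T₁/2)·log₂((s₂/s₁)·(2^{2B₁₁/T₁} − 1) + 1)`;
in particular `F` is bounded above on `(0, ∞)`. -/
theorem F_tendsto_atTop (σ2 s1 s2 T1 E B11 B12 : ℝ)
    (hσ : 0 < σ2) (hs2 : 0 < s2) (hs : s2 < s1) (hT1 : 0 < T1) (hE : 0 < E)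
    (hB11 : 0 ≤ B11) (hB12 : 0 < B12) :
    Filter.Tendsto (F σ2 s1 s2 T1 E B11 B12) Filter.atTop
      (nhds (E * s2 / (2 * Real.log 2 * σ2) - (s2 / s1) * B12
        - (T1 / 2) * Real.logb 2 ((s2 / s1) * ((2:ℝ) ^ (2 * B11 / T1) - 1) + 1))) ∧
    ∃ M : ℝ, ∀ T2, 0 < T2 → F σ2 s1 s2 T1 E B11 B12 T2 ≤ M := by
  have hs1 : 0 < s1 := hs2.trans hs
  have hF {T2 : ℝ} (hT2 : 0 < T2) :=
    F_eq_normalized hσ hs1 hs2 hT1 hE.le hB11 hB12.le hT2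
  have hlog2 : 0 < Real.log 2 := Real.log_pos one_lt_two
  constructor
  · have henergy := ((tendsto_mul_logb_one_add_div_atTop 2 (E * s2 / σ2)).comp
      (tendsto_atTop_add_const_left atTop T1 tendsto_id)).div_const 2
    have hrate :=
      (tendsto_mul_logb_rpow_div_atTop one_lt_two (s2 / s1) (2 * B12)).div_const 2
    have hlim := (henergy.sub hrate).sub_const
      ((T1 / 2) * Real.logb 2 ((s2 / s1) * ((2 : ℝ) ^ (2 * B11 / T1) - 1) + 1))
    convert hlim.congr' ?_ using 2
    · field_simp
    · filter_upwards [eventually_gt_atTop 0] with T2 hT2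
      exact (hF hT2).symm
  · refine ⟨E * s2 / σ2 / Real.log 2 / 2
      - (T1 / 2) * Real.logb 2 ((s2 / s1) * ((2 : ℝ) ^ (2 * B11 / T1) - 1) + 1),
      fun T2 hT2 => ?_⟩
    rw [hF hT2]
    have hT : 0 < T1 + T2 := by positivity
    have henergy : (T1 + T2) * Real.logb 2 (1 + E * s2 / σ2 / (T1 + T2)) ≤
        E * s2 / σ2 / Real.log 2 := by
      have hle : Real.log (1 + E * s2 / σ2 / (T1 + T2)) ≤ E * s2 / σ2 / (T1 + T2) := by
        linarith [Real.log_le_sub_one_of_pos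
          (show 0 < 1 + E * s2 / σ2 / (T1 + T2) by positivity)]
      rw [Real.logb, ← mul_div_assoc]
      gcongr
      exact (le_div_iff₀' hT).mp hle
    have hone : (0 : ℝ) ≤ (2 : ℝ) ^ (2 * B12 / T2) - 1 :=
      sub_nonneg.mpr (Real.one_le_rpow one_le_two (by positivity))
    have hrate : 0 ≤ T2 * Real.logb 2 ((s2 / s1) * ((2 : ℝ) ^ (2 * B12 / T2) - 1) + 1) :=
      mul_nonneg hT2.le (Real.logb_nonneg one_lt_two (le_add_of_nonneg_left (by positivity)))
    linarith
end

section
/- The function F is strictly increasing on (0, ∞); consequently, for every target bit amount B₂ with lim_{T₂→0⁺} F(T₂) < B₂ < lim_{T₂→∞} F(T₂), there exists exactly one T₂ > 0 with F(T₂) = B₂ (the quantity computed by the bisection step of the local time-minimization routine). Here lim_{T₂→0⁺} F(T₂) = (T₁/2)·log₂(E/T₁ + σ²/s₂) − (T₁/2)·log₂((σ²/s₁)·(2^{2B₁₁/T₁} − 1) + σ²/s₂) − B₁₂ and lim_{T₂→∞} F(T₂) = E·s₂/(2·ln 2·σ²) − (s₂/s₁)·B₁₂ − (T₁/2)·log₂((s₂/s₁)·(2^{2B₁₁/T₁}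 − 1) + 1). -/
open Real Set Filter

theorem strictMonoOn_mul_log_one_add_div {K : ℝ} (hK : 0 < K) :
    StrictMonoOn (fun T : ℝ => T * log (1 + K / T)) (Ioi 0) := by
  intro T (hT : 0 < T) T' (hT' : 0 < T') hlt
  have hp : T / T' < 1 := (div_lt_one hT').2 hlt
  have hbern := rpow_one_add_lt_one_add_mul_self (s := K / T) (p := T / T')
    (by linarith [div_pos hK hT]) (div_pos hK hT).ne' (div_pos hT hT') hp
  have hmul : T / T' * (K / T) = K / T' := by field_simp
  rw [hmul] at hbern
  have hlog := Real.log_lt_log (by positivity) hbern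
  rw [Real.log_rpow (by positivity)] at hlog
  calc T * log (1 + K / T) = T' * (T / T' * log (1 + K / T)) := by field_simp
    _ < T' * log (1 + K / T') := by gcongr

theorem mixture_exp_pos {a : ℝ} (ha : 0 < a) (ha1 : a < 1) (x : ℝ) :
    0 < a * (exp x - 1) + 1 := by
  nlinarith [mul_pos ha (exp_pos x)]

theorem antitoneOn_mul_log_mixture_exp {a : ℝ} (b : ℝ) (ha : 0 < a) (ha1 : a < 1) :
    AntitoneOn (fun T : ℝ => T * log (a * (exp (b / T) - 1) + 1)) (Ioi 0) := by
  intro T (hT : 0 < T) T' (hT' : 0 < T') hle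
  have hconc := (Real.concaveOn_rpow (p := T / T') (by positivity)
    ((div_le_one hT').2 hle)).2 (x := exp (b / T)) (y := 1) (exp_pos _).le
    (mem_Ici.2 zero_le_one) ha.le (sub_pos.2 ha1).le (by ring)
  have hexp : exp (b / T) ^ (T / T') = exp (b / T') := by
    rw [← Real.exp_mul]
    congr 1
    field_simp
  simp only [smul_eq_mul, Real.one_rpow, hexp] at hconc
  have hbase : a * exp (b / T) + (1 - a) * 1 = a * (exp (b / T) - 1) + 1 := by ring
  rw [hbase] at hconc
  have hlog : log (a * (exp (b / T') - 1) + 1) ≤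
      T / T' * log (a * (exp (b / T) - 1) + 1) := by
    rw [← Real.log_rpow (mixture_exp_pos ha ha1 _)]
    exact Real.log_le_log (mixture_exp_pos ha ha1 _) (by linarith)
  calc T' * log (a * (exp (b / T') - 1) + 1)
      ≤ T' * (T / T' * log (a * (exp (b / T) - 1) + 1)) := by gcongr
    _ = T * log (a * (exp (b / T) - 1) + 1) := by field_simp

theorem tendsto_mul_comp_inv_atTop {f : ℝ → ℝ} {d : ℝ} (hf : HasDerivAt f d 0)
    (hf0 : f 0 = 0) : Tendsto (fun T : ℝ => T * f T⁻¹) atTop (nhds d) := by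
  have hslope := hf.tendsto_slope_zero_right.comp tendsto_inv_atTop_nhdsGT_zero
  refine hslope.congr fun T => ?_
  simp [hf0]

theorem tendsto_mul_log_mixture_exp_atTop (a b : ℝ) :
    Tendsto (fun T : ℝ => T * log (a * (exp (b / T) - 1) + 1)) atTop (nhds (a * b)) := by
  have hd : HasDerivAt (fun u : ℝ => log (a * (exp (b * u) - 1) + 1)) (a * b) 0 := by
    have h := ((((((hasDerivAt_id (0 : ℝ)).const_mul b).exp).sub_const 1).const_mul a).add_const
      1).log (by simp)
    simpa using h
  simpa only [div_eq_mul_inv] using tendsto_mul_comp_inv_atTop hd (by simp)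

theorem tendsto_mul_log_mixture_exp_nhdsGT_zero {a b : ℝ} (ha : 0 < a) (ha1 : a < 1)
    (hb : 0 < b) :
    Tendsto (fun T : ℝ => T * log (a * (exp (b / T) - 1) + 1)) (nhdsWithin 0 (Ioi 0))
      (nhds b) := by
  have hid : Tendsto (fun T : ℝ => T) (nhdsWithin 0 (Ioi 0)) (nhds 0) :=
    tendsto_id.mono_left nhdsWithin_le_nhds
  have hexp : Tendsto (fun T : ℝ => exp (-(b * T⁻¹))) (nhdsWithin 0 (Ioi 0)) (nhds 0) :=
    Real.tendsto_exp_neg_atTop_nhds_zero.comp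
      (tendsto_inv_nhdsGT_zero.const_mul_atTop hb)
  have hlog : Tendsto (fun T : ℝ => log (a + (1 - a) * exp (-(b * T⁻¹))))
      (nhdsWithin 0 (Ioi 0)) (nhds (log a)) := by
    have h := (hexp.const_mul (1 - a)).const_add a
    rw [mul_zero, add_zero] at h
    exact h.log ha.ne'
  have hsum := (hid.mul hlog).const_add b
  rw [zero_mul, add_zero] at hsum
  refine hsum.congr' ?_
  filter_upwards [self_mem_nhdsWithin] with T (hT : 0 < T)
  have hpos : 0 < a + (1 - a) * exp (-(b * T⁻¹)) := by
    have := mul_pos (sub_pos.2 ha1) (exp_pos (-(b * T⁻¹)))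
    linarith
  have hfac : a * (exp (b / T) - 1) + 1 =
      exp (b / T) * (a + (1 - a) * exp (-(b * T⁻¹))) := by
    have : exp (b / T) * exp (-(b * T⁻¹)) = 1 := by
      rw [← Real.exp_add, div_eq_mul_inv, add_neg_cancel, Real.exp_zero]
    linear_combination (a - 1) * this
  rw [hfac, Real.log_mul (exp_pos _).ne' hpos.ne', Real.log_exp]
  field_simp

theorem logb_noise_factor {σ2 s2 x : ℝ} (hσ : 0 < σ2) (hs2 : 0 < s2) (hx : 0 < x) :
    logb 2 (σ2 / s2 * x) = logb 2 (σ2 / s2) + logb 2 x :=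
  Real.logb_mul (div_pos hσ hs2).ne' hx.ne'

theorem logb_energy {σ2 s2 E T : ℝ} (hσ : 0 < σ2) (hs2 : 0 < s2) (hE : 0 < E) (hT : 0 < T) :
    logb 2 (E / T + σ2 / s2) = logb 2 (σ2 / s2) + logb 2 (1 + E * s2 / σ2 / T) := by
  rw [← logb_noise_factor hσ hs2 (by positivity)]
  congr 1
  field_simp
  ring

theorem logb_interference {σ2 s1 s2 : ℝ} (hσ : 0 < σ2) (hs2 : 0 < s2) (hs : s2 < s1) (x : ℝ) :
    logb 2 (σ2 / s1 * ((2 : ℝ) ^ x - 1) + σ2 / s2) =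
      logb 2 (σ2 / s2) + logb 2 (s2 / s1 * ((2 : ℝ) ^ x - 1) + 1) := by
  have hs1 : 0 < s1 := hs2.trans hs
  rw [← logb_noise_factor hσ hs2]
  · congr 1
    field_simp
  · rw [Real.rpow_def_of_pos two_pos]
    exact mixture_exp_pos (div_pos hs2 hs1) ((div_lt_one hs1).2 hs) _

theorem F_eq {σ2 s1 s2 T1 E T2 : ℝ} (B11 B12 : ℝ) (hσ : 0 < σ2) (hs2 : 0 < s2)
    (hs : s2 < s1) (hT1 : 0 < T1) (hE : 0 < E) (hT2 : 0 < T2) :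
    F σ2 s1 s2 T1 E B11 B12 T2 =
      ((T1 + T2) * log (1 + E * s2 / σ2 / (T1 + T2))
        - T2 * log (s2 / s1 * (exp (2 * log 2 * B12 / T2) - 1) + 1)) / (2 * log 2)
      - (T1 / 2) * logb 2 (s2 / s1 * ((2 : ℝ) ^ (2 * B11 / T1) - 1) + 1) := by
  have hrpow : (2 : ℝ) ^ (2 * B12 / T2) = exp (2 * log 2 * B12 / T2) := by
    rw [Real.rpow_def_of_pos two_pos]
    congr 1
    ring
  have hlog2 : log 2 ≠ 0 := (Real.log_pos one_lt_two).ne'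
  rw [F, logb_energy hσ hs2 hE (by positivity), logb_interference hσ hs2 hs,
    logb_interference hσ hs2 hs, hrpow]
  simp only [Real.logb]
  field_simp
  ring

/-- `F` is strictly increasing on `(0, ∞)`; consequently every target bit amount `B₂`
strictly between the limit of `F` at `0⁺` and its limit at `∞` is attained at exactly
one `T₂ > 0` (the quantity computed by the bisection step of the local
time-minimization routine). -/
theorem F_strictMono_and_unique_solution (σ2 s1 s2 T1 E B11 B12 : ℝ)
    (hσ : 0 < σ2) (hs2 : 0 < s2) (hs : s2 < s1) (hT1 : 0 < T1) (hE : 0 < E)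
    (hB11 : 0 ≤ B11) (hB12 : 0 < B12) :
    StrictMonoOn (F σ2 s1 s2 T1 E B11 B12) (Set.Ioi (0:ℝ)) ∧
    Filter.Tendsto (F σ2 s1 s2 T1 E B11 B12) (nhdsWithin 0 (Set.Ioi (0:ℝ)))
      (nhds ((T1 / 2) * Real.logb 2 (E / T1 + σ2 / s2)
        - (T1 / 2) * Real.logb 2 ((σ2 / s1) * ((2:ℝ) ^ (2 * B11 / T1) - 1) + σ2 / s2)
        - B12)) ∧
    Filter.Tendsto (F σ2 s1 s2 T1 E B11 B12) Filter.atTop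
      (nhds (E * s2 / (2 * Real.log 2 * σ2) - (s2 / s1) * B12
        - (T1 / 2) * Real.logb 2 ((s2 / s1) * ((2:ℝ) ^ (2 * B11 / T1) - 1) + 1))) ∧
    ∀ B2 : ℝ,
      (T1 / 2) * Real.logb 2 (E / T1 + σ2 / s2)
        - (T1 / 2) * Real.logb 2 ((σ2 / s1) * ((2:ℝ) ^ (2 * B11 / T1) - 1) + σ2 / s2)
        - B12 < B2 →
      B2 < E * s2 / (2 * Real.log 2 * σ2) - (s2 / s1) * B12
        - (T1 / 2) * Real.logb 2 ((s2 / s1) * ((2:ℝ) ^ (2 * B11 / T1) - 1) + 1) →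
      ∃! T2 : ℝ, 0 < T2 ∧ F σ2 s1 s2 T1 E B11 B12 T2 = B2 := by
  have hs1 : 0 < s1 := hs2.trans hs
  have ha : 0 < s2 / s1 := div_pos hs2 hs1
  have ha1 : s2 / s1 < 1 := (div_lt_one hs1).2 hs
  have hK : 0 < E * s2 / σ2 := by positivity
  have hlog2 : 0 < log 2 := Real.log_pos one_lt_two
  have hb : 0 < 2 * log 2 * B12 := by positivity
  have hF : ∀ T2 : ℝ, 0 < T2 → _ := fun T2 hT2 => F_eq B11 B12 hσ hs2 hs hT1 hE hT2
  have hmono : StrictMonoOn (F σ2 s1 s2 T1 E B11 B12) (Ioi 0) := by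
    intro x (hx : 0 < x) y (hy : 0 < y) hxy
    rw [hF x hx, hF y hy]
    have hg := strictMonoOn_mul_log_one_add_div hK (mem_Ioi.2 (add_pos hT1 hx))
      (mem_Ioi.2 (add_pos hT1 hy)) (add_lt_add_right hxy T1)
    have hh := antitoneOn_mul_log_mixture_exp (2 * log 2 * B12) ha ha1
      (mem_Ioi.2 hx) (mem_Ioi.2 hy) hxy.le
    dsimp only at hg hh
    gcongr ?_ / _ - _
    linarith
  have hzero : Tendsto (F σ2 s1 s2 T1 E B11 B12) (nhdsWithin 0 (Ioi 0))
      (nhds ((T1 / 2) * logb 2 (E / T1 + σ2 / s2)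
        - (T1 / 2) * logb 2 ((σ2 / s1) * ((2 : ℝ) ^ (2 * B11 / T1) - 1) + σ2 / s2)
        - B12)) := by
    have hg : Tendsto (fun T2 : ℝ => (T1 + T2) * log (1 + E * s2 / σ2 / (T1 + T2)))
        (nhdsWithin 0 (Ioi 0)) (nhds (T1 * log (1 + E * s2 / σ2 / T1))) := by
      have hc : ContinuousAt
          (fun T2 : ℝ => (T1 + T2) * log (1 + E * s2 / σ2 / (T1 + T2))) 0 := by
        have h1 : T1 + 0 ≠ 0 := by simpa using hT1.ne'
        have h2 : 1 + E * s2 / σ2 / (T1 + 0) ≠ 0 := by rw [add_zero]; positivity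
        fun_prop (disch := assumption)
      simpa using hc.tendsto.mono_left nhdsWithin_le_nhds
    have hlim := ((hg.sub (tendsto_mul_log_mixture_exp_nhdsGT_zero ha ha1 hb)).div_const
      (2 * log 2)).sub_const
        ((T1 / 2) * logb 2 (s2 / s1 * ((2 : ℝ) ^ (2 * B11 / T1) - 1) + 1))
    rw [logb_energy hσ hs2 hE hT1, logb_interference hσ hs2 hs]
    refine (hlim.congr' ?_).trans_eq ?_
    · filter_upwards [self_mem_nhdsWithin] with T2 hT2 using (hF T2 hT2).symm
    · congr 1
      simp only [Real.logb]
      field_simp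
      ring
  have htop : Tendsto (F σ2 s1 s2 T1 E B11 B12) atTop
      (nhds (E * s2 / (2 * log 2 * σ2) - (s2 / s1) * B12
        - (T1 / 2) * logb 2 ((s2 / s1) * ((2 : ℝ) ^ (2 * B11 / T1) - 1) + 1))) := by
    have hg := (Real.tendsto_mul_log_one_add_div_atTop (E * s2 / σ2)).comp
      (tendsto_atTop_add_const_left atTop T1 tendsto_id)
    have hlim := ((hg.sub (tendsto_mul_log_mixture_exp_atTop (s2 / s1)
      (2 * log 2 * B12))).div_const (2 * log 2)).sub_const
        ((T1 / 2) * logb 2 (s2 / s1 * ((2 : ℝ) ^ (2 * B11 / T1) - 1) + 1))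
    refine (hlim.congr' ?_).trans_eq ?_
    · filter_upwards [eventually_gt_atTop 0] with T2 hT2 using (hF T2 hT2).symm
    · congr 2
      field_simp
  have hcont : ContinuousOn (F σ2 s1 s2 T1 E B11 B12) (Ioi 0) := by
    refine ContinuousOn.congr (fun T2 (hT2 : 0 < T2) => ContinuousAt.continuousWithinAt ?_) hF
    have h1 : T1 + T2 ≠ 0 := by positivity
    have h2 : 1 + E * s2 / σ2 / (T1 + T2) ≠ 0 := by positivity
    have h3 := (mixture_exp_pos ha ha1 (2 * log 2 * B12 / T2)).ne'
    have h4 := hT2.ne'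
    fun_prop (disch := first | assumption | positivity)
  refine ⟨hmono, hzero, htop, fun B2 hlo hhi => ?_⟩
  obtain ⟨T2, hT2, hB2⟩ := isPreconnected_Ioi.intermediate_value_Ioo
    (l₁ := nhdsWithin 0 (Ioi 0)) inf_le_right
    (le_principal_iff.2 (Ioi_mem_atTop 0)) hcont hzero htop ⟨hlo, hhi⟩
  exact ⟨T2, ⟨hT2, hB2⟩, fun y hy => hmono.injOn hy.1 hT2 (hy.2.trans hB2.symm)⟩
end
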